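/- Let H be a hypergraph and K a field. Then the images in L_K(H) of the nod-paths form a basis of L_K(H) as a K-vector space. -/

import Mathlib

open scoped Classical

/-- The generators of the Leavitt path algebra of a hypergraph `H = (H0, H1, s, r)`:
a vertex generator `v` for every `v ∈ H0`, and generators `h_{ij}` (`edge`) and
`h_{ij}^*` (`ghost`) for every hyperedge `h ∈ H1`, `1 ≤ i ≤ |s(h)|`, `1 ≤ j ≤ |r(h)|`.
The multisets `s(h)` and `r(h)` are given as (enumerated) lists over `H0`. -/
inductive HGen (H0 H1 : Type) (s r : H1 → List H0) : Type
  | vertex (v : H0) : HGen H0 H1 s r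
  | edge (h : H1) (i : Fin (s h).length) (j : Fin (r h).length) : HGen H0 H1 s r
  | ghost (h : H1) (i : Fin (s h).length) (j : Fin (r h).length) : HGen H0 H1 s r

namespace HLPA

variable (K : Type) [Field K] (H0 H1 : Type) (s r : H1 → List H0)

/-- The defining relations (i)-(iv) of the Leavitt path algebra of a hypergraph,
imposed on the free algebra on the generators. -/
inductive Rel : FreeAlgebra K (HGen H0 H1 s r) → FreeAlgebra K (HGen H0 H1 s r) → Prop
  | vtx (u v : H0) :
      Rel (FreeAlgebra.ι K (HGen.vertex u : HGen H0 H1 s r) * FreeAlgebra.ι K (HGen.vertex v))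
        (if u = v then FreeAlgebra.ι K (HGen.vertex u : HGen H0 H1 s r) else 0)
  | src_edge (h : H1) (i : Fin (s h).length) (j : Fin (r h).length) :
      Rel (FreeAlgebra.ι K (HGen.vertex ((s h).get i) : HGen H0 H1 s r) *
            FreeAlgebra.ι K (HGen.edge h i j))
        (FreeAlgebra.ι K (HGen.edge h i j))
  | edge_rng (h : H1) (i : Fin (s h).length) (j : Fin (r h).length) :
      Rel (FreeAlgebra.ι K (HGen.edge h i j : HGen H0 H1 s r) *
            FreeAlgebra.ι K (HGen.vertex ((r h).get j)))
        (FreeAlgebra.ι K (HGen.edge h i j))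
  | rng_ghost (h : H1) (i : Fin (s h).length) (j : Fin (r h).length) :
      Rel (FreeAlgebra.ι K (HGen.vertex ((r h).get j) : HGen H0 H1 s r) *
            FreeAlgebra.ι K (HGen.ghost h i j))
        (FreeAlgebra.ι K (HGen.ghost h i j))
  | ghost_src (h : H1) (i : Fin (s h).length) (j : Fin (r h).length) :
      Rel (FreeAlgebra.ι K (HGen.ghost h i j : HGen H0 H1 s r) *
            FreeAlgebra.ι K (HGen.vertex ((s h).get i)))
        (FreeAlgebra.ι K (HGen.ghost h i j))
  | cuntz1 (h : H1) (i i' : Fin (s h).length) :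
      Rel (∑ k : Fin (r h).length,
            FreeAlgebra.ι K (HGen.edge h i k : HGen H0 H1 s r) *
              FreeAlgebra.ι K (HGen.ghost h i' k))
        (if i = i' then FreeAlgebra.ι K (HGen.vertex ((s h).get i) : HGen H0 H1 s r) else 0)
  | cuntz2 (h : H1) (j j' : Fin (r h).length) :
      Rel (∑ k : Fin (s h).length,
            FreeAlgebra.ι K (HGen.ghost h k j : HGen H0 H1 s r) *
              FreeAlgebra.ι K (HGen.edge h k j'))
        (if j = j' then FreeAlgebra.ι K (HGen.vertex ((r h).get j) : HGen H0 H1 s r) else 0)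

/-- The universal unital algebra on the generators subject to the relations (i)-(iv);
it is the unitalization of the Leavitt path algebra of the hypergraph. -/
abbrev Ambient : Type := RingQuot (Rel K H0 H1 s r)

/-- The image of a generator in the ambient algebra. -/
noncomputable def amb (g : HGen H0 H1 s r) : Ambient K H0 H1 s r :=
  RingQuot.mkAlgHom K (Rel K H0 H1 s r) (FreeAlgebra.ι K g)

/-- The Leavitt path algebra of the hypergraph `(H0, H1, s, r)`, realized as the
non-unital subalgebra generated by the generators inside the universal unital algebra
on the generators subject to the relations (i)-(iv). (This is the algebra presented,
in the category of not necessarily unital `K`-algebras, by said generators and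
relations.) -/
noncomputable def LPAsub : NonUnitalSubalgebra K (Ambient K H0 H1 s r) :=
  NonUnitalAlgebra.adjoin K (Set.range (amb K H0 H1 s r))

/-- The Leavitt path algebra `L_K(H)` of the hypergraph `H = (H0, H1, s, r)`. -/
abbrev LPA : Type := ↥(LPAsub K H0 H1 s r)

variable {H0 H1 s r}

/-- A generator, as an element of the Leavitt path algebra. -/
noncomputable def genL (g : HGen H0 H1 s r) : LPA K H0 H1 s r :=
  ⟨amb K H0 H1 s r g, NonUnitalAlgebra.subset_adjoin K (Set.mem_range_self g)⟩

/-- The vertex generator `v ∈ H0` as an element of the Leavitt path algebra. -/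
noncomputable def vgen (v : H0) : LPA K H0 H1 s r := genL K (HGen.vertex v)

/-- The generator `h_{ij}` as an element of the Leavitt path algebra. -/
noncomputable def egen (h : H1) (i : Fin (s h).length) (j : Fin (r h).length) :
    LPA K H0 H1 s r := genL K (HGen.edge h i j)

/-- The generator `h_{ij}^*` as an element of the Leavitt path algebra. -/
noncomputable def ggen (h : H1) (i : Fin (s h).length) (j : Fin (r h).length) :
    LPA K H0 H1 s r := genL K (HGen.ghost h i j)

end HLPA

namespace HLPA

variable (K : Type) [Field K] (H0 H1 : Type) (s r : H1 → List H0)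

noncomputable instance instLPANonUnitalRing : NonUnitalRing (LPA K H0 H1 s r) :=
  NonUnitalSubalgebra.toNonUnitalRing (LPAsub K H0 H1 s r)

noncomputable instance instLPAAddCommGroup : AddCommGroup (LPA K H0 H1 s r) :=
  (instLPANonUnitalRing K H0 H1 s r).toAddCommGroup

noncomputable instance instLPAModule : Module K (LPA K H0 H1 s r) :=
  (LPAsub K H0 H1 s r).instModule

end HLPA

namespace HLPA

variable {H0 H1 : Type} {s r : H1 → List H0}

/-- The source vertex of a letter (edge, ghost edge or vertex) in the double graph of
the directed graph associated to the hypergraph. -/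
def letterSrc : HGen H0 H1 s r → H0
  | .vertex v => v
  | .edge h i _ => (s h).get i
  | .ghost h _ j => (r h).get j

/-- The range vertex of a letter in the double graph of the directed graph associated
to the hypergraph. -/
def letterRng : HGen H0 H1 s r → H0
  | .vertex v => v
  | .edge h _ j => (r h).get j
  | .ghost h i _ => (s h).get i

/-- Whether a letter is a vertex letter. -/
def IsVertexLetter : HGen H0 H1 s r → Prop
  | .vertex _ => True
  | _ => False

/-- A d-path: a path in the double graph of the directed graph associated to the
hypergraph, i.e. either a single vertex (length `0`), or a nonempty word of edges and
ghost edges in which the range of each letter is the source of the next one. -/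
def IsDPath (l : List (HGen H0 H1 s r)) : Prop :=
  (∃ v : H0, l = [HGen.vertex v]) ∨
    (l ≠ [] ∧ (∀ x ∈ l, ¬ IsVertexLetter x) ∧
      l.Chain' fun x y => letterRng x = letterSrc y)

/-- The forbidden two-letter words `h_{i1} h_{j1}^*` and `h_{1i}^* h_{1j}`
(indices here are `0`-based, so `1` becomes `0`). -/
def Forbidden : HGen H0 H1 s r → HGen H0 H1 s r → Prop
  | .edge h _ j, .ghost h' _ j' => h = h' ∧ (j : ℕ) = 0 ∧ (j' : ℕ) = 0
  | .ghost h i _, .edge h' i' _ => h = h' ∧ (i : ℕ) = 0 ∧ (i' : ℕ) = 0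
  | _, _ => False

/-- A nod-path (normal d-path): a d-path none of whose subwords is forbidden. -/
def IsNodPath (l : List (HGen H0 H1 s r)) : Prop :=
  IsDPath l ∧ l.Chain' fun x y => ¬ Forbidden x y

/-- The length of a d-path: `0` for a single vertex, and the word length otherwise. -/
def nodLength : List (HGen H0 H1 s r) → ℕ
  | [HGen.vertex _] => 0
  | l => l.length

variable (K : Type) [Field K]

/-- The image of a word over the generators in the Leavitt path algebra
(the product of its letters; junk value `0` for the empty word). -/
noncomputable def wordProd : List (HGen H0 H1 s r) → LPA K H0 H1 s r
  | [] => 0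
  | [g] => genL K g
  | g :: g' :: t => genL K g * wordProd (g' :: t)

end HLPA

namespace HLPA

variable {H0 H1 : Type} {s r : H1 → List H0}

/-- The letter `y` may follow the letter `x` in a nod-path. -/
def Follows (x y : HGen H0 H1 s r) : Prop :=
  letterRng x = letterSrc y ∧ ¬ IsVertexLetter y ∧ ¬ Forbidden x y

/-- The word `l` of edges and ghost edges is a nod-path starting at `v`; the empty word is read
as the vertex `v`. -/
def NodFrom (v : H0) (l : List (HGen H0 H1 s r)) : Prop :=
  List.IsChain Follows (HGen.vertex v :: l)

theorem nodFrom_nil (v : H0) : NodFrom v ([] : List (HGen H0 H1 s r)) := by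
  simp [NodFrom]

theorem nodFrom_cons {v : H0} {x : HGen H0 H1 s r} {l : List (HGen H0 H1 s r)} :
    NodFrom v (x :: l) ↔ v = letterSrc x ∧ ¬ IsVertexLetter x ∧
      NodFrom (letterRng x) l ∧ ∀ y q, l = y :: q → ¬ Forbidden x y := by
  cases l with
  | nil => simp [NodFrom, Follows, letterRng, Forbidden]
  | cons y q =>
    simp only [NodFrom, List.isChain_cons_cons, Follows, letterRng, Forbidden, List.cons.injEq]
    constructor
    · rintro ⟨⟨h1, h2, -⟩, ⟨h3, h4, h5⟩, h6⟩
      refine ⟨h1, h2, ⟨⟨h3, h4, not_false⟩, h6⟩, ?_⟩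
      rintro _ _ ⟨rfl, -⟩
      exact h5
    · rintro ⟨h1, h2, ⟨⟨h3, h4, -⟩, h6⟩, h7⟩
      exact ⟨⟨h1, h2, not_false⟩, ⟨h3, h4, h7 y q ⟨rfl, rfl⟩⟩, h6⟩

theorem nodFrom_edge_cons {h : H1} {i : Fin (s h).length} {j : Fin (r h).length}
    {l : List (HGen H0 H1 s r)} (hl : NodFrom ((r h).get j) l)
    (hf : ¬ ∃ a q, l = HGen.ghost h a j :: q ∧ (j : ℕ) = 0) :
    NodFrom ((s h).get i) (HGen.edge h i j :: l) := by
  refine nodFrom_cons.2 ⟨rfl, id, hl, ?_⟩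
  rintro y q rfl hy
  cases y with
  | vertex v => exact hy
  | edge h' a b => exact hy
  | ghost h' a b =>
    obtain ⟨rfl, hj, hb⟩ := hy
    obtain rfl : b = j := Fin.ext (hb.trans hj.symm)
    exact hf ⟨a, q, rfl, hj⟩

theorem nodFrom_ghost_cons {h : H1} {i : Fin (s h).length} {j : Fin (r h).length}
    {l : List (HGen H0 H1 s r)} (hl : NodFrom ((s h).get i) l)
    (hf : ¬ ∃ b q, l = HGen.edge h i b :: q ∧ (i : ℕ) = 0) :
    NodFrom ((r h).get j) (HGen.ghost h i j :: l) := by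
  refine nodFrom_cons.2 ⟨rfl, id, hl, ?_⟩
  rintro y q rfl hy
  cases y with
  | vertex v => exact hy
  | ghost h' a b => exact hy
  | edge h' a b =>
    obtain ⟨rfl, hi, ha⟩ := hy
    obtain rfl : a = i := Fin.ext (ha.trans hi.symm)
    exact hf ⟨b, q, rfl, hi⟩

theorem NodFrom.ghost_index {v : H0} {h : H1} {i : Fin (s h).length} {j : Fin (r h).length}
    {l : List (HGen H0 H1 s r)} (hl : NodFrom v (HGen.ghost h i j :: l))
    (k : Fin (r h).length) : NodFrom ((r h).get k) (HGen.ghost h i k :: l) := by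
  obtain ⟨-, -, h1, h2⟩ := nodFrom_cons.1 hl
  refine nodFrom_cons.2 ⟨rfl, id, h1, fun y q hy hf => h2 y q hy ?_⟩
  cases y <;> exact hf

theorem NodFrom.edge_index {v : H0} {h : H1} {i : Fin (s h).length} {j : Fin (r h).length}
    {l : List (HGen H0 H1 s r)} (hl : NodFrom v (HGen.edge h i j :: l))
    (k : Fin (s h).length) : NodFrom ((s h).get k) (HGen.edge h k j :: l) := by
  obtain ⟨-, -, h1, h2⟩ := nodFrom_cons.1 hl
  refine nodFrom_cons.2 ⟨rfl, id, h1, fun y q hy hf => h2 y q hy ?_⟩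
  cases y <;> exact hf

theorem NodFrom.tail {v : H0} {x : HGen H0 H1 s r} {l : List (HGen H0 H1 s r)}
    (hl : NodFrom v (x :: l)) : NodFrom (letterRng x) l :=
  (nodFrom_cons.1 hl).2.2.1

theorem NodFrom.edge_ghost {v : H0} {h : H1} {a : Fin (s h).length} {j : Fin (r h).length}
    {l : List (HGen H0 H1 s r)} (hl : NodFrom v (HGen.ghost h a j :: l))
    (i : Fin (s h).length) {k : Fin (r h).length} (hk : (k : ℕ) ≠ 0) :
    NodFrom ((s h).get i) (HGen.edge h i k :: HGen.ghost h a k :: l) :=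
  nodFrom_edge_cons (hl.ghost_index k) (by rintro ⟨-, -, -, h0⟩; exact hk h0)

theorem NodFrom.ghost_edge {v : H0} {h : H1} {i : Fin (s h).length} {b : Fin (r h).length}
    {l : List (HGen H0 H1 s r)} (hl : NodFrom v (HGen.edge h i b :: l))
    (j : Fin (r h).length) {k : Fin (s h).length} (hk : (k : ℕ) ≠ 0) :
    NodFrom ((r h).get j) (HGen.ghost h k j :: HGen.edge h k b :: l) :=
  nodFrom_ghost_cons (hl.edge_index k) (by rintro ⟨-, -, -, h0⟩; exact hk h0)

variable (K : Type) [Field K]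

/-- The free vector space on pairs consisting of a source vertex and a word. -/
abbrev WordSpace (H0 H1 : Type) (s r : H1 → List H0) : Type :=
  (H0 × List (HGen H0 H1 s r)) →₀ K

/-- The basis vector of `WordSpace` given by the word `l` starting at `v`. -/
noncomputable abbrev wordVec (v : H0) (l : List (HGen H0 H1 s r)) : WordSpace K H0 H1 s r :=
  Finsupp.single (v, l) 1

/-- The normal form of the product of a letter with a composable nod-path. -/
noncomputable def reduceCons : HGen H0 H1 s r → List (HGen H0 H1 s r) → WordSpace K H0 H1 s r
  | .vertex v, l => wordVec K v l
  | .edge h i j, l =>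
      if hl : ∃ a q, l = HGen.ghost h a j :: q ∧ (j : ℕ) = 0 then
        (if i = hl.choose then wordVec K ((s h).get i) hl.choose_spec.choose else 0) -
          ∑ k : Fin (r h).length, if (k : ℕ) = 0 then 0 else
            wordVec K ((s h).get i)
              (HGen.edge h i k :: HGen.ghost h hl.choose k :: hl.choose_spec.choose)
      else wordVec K ((s h).get i) (HGen.edge h i j :: l)
  | .ghost h i j, l =>
      if hl : ∃ b q, l = HGen.edge h i b :: q ∧ (i : ℕ) = 0 then
        (if j = hl.choose then wordVec K ((r h).get j) hl.choose_spec.choose else 0) -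
          ∑ k : Fin (s h).length, if (k : ℕ) = 0 then 0 else
            wordVec K ((r h).get j)
              (HGen.ghost h k j :: HGen.edge h k hl.choose :: hl.choose_spec.choose)
      else wordVec K ((r h).get j) (HGen.ghost h i j :: l)

/-- The action of a letter on `WordSpace` by left multiplication and reduction. -/
noncomputable def letterAct (g : HGen H0 H1 s r) : Module.End K (WordSpace K H0 H1 s r) :=
  Finsupp.linearCombination K fun w =>
    if NodFrom w.1 w.2 ∧ letterRng g = w.1 then reduceCons K g w.2 else 0

theorem letterAct_wordVec {g : HGen H0 H1 s r} {v : H0} {l : List (HGen H0 H1 s r)}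
    (hl : NodFrom v l) (hv : letterRng g = v) :
    letterAct K g (wordVec K v l) = reduceCons K g l := by
  simp [letterAct, hl, hv]

theorem letterAct_of_ne {g : HGen H0 H1 s r} {v : H0} {l : List (HGen H0 H1 s r)}
    (hv : letterRng g ≠ v) : letterAct K g (wordVec K v l) = 0 := by
  simp [letterAct, hv]

theorem letterAct_of_not_nodFrom {g : HGen H0 H1 s r} {v : H0} {l : List (HGen H0 H1 s r)}
    (hl : ¬ NodFrom v l) : letterAct K g (wordVec K v l) = 0 := by
  simp [letterAct, hl]

theorem reduceCons_edge_ghost (h : H1) (i a : Fin (s h).length) {j : Fin (r h).length}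
    (hj : (j : ℕ) = 0) (q : List (HGen H0 H1 s r)) :
    reduceCons K (HGen.edge h i j) (HGen.ghost h a j :: q) =
      (if i = a then wordVec K ((s h).get i) q else 0) -
        ∑ k : Fin (r h).length, if (k : ℕ) = 0 then 0 else
          wordVec K ((s h).get i) (HGen.edge h i k :: HGen.ghost h a k :: q) := by
  have hl : ∃ a' q', HGen.ghost h a j :: q = HGen.ghost h a' j :: q' ∧ (j : ℕ) = 0 :=
    ⟨a, q, rfl, hj⟩
  have hinj : ∀ a' q', HGen.ghost h a j :: q = HGen.ghost h a' j :: q' → a' = a ∧ q' = q := by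
    rintro _ _ ⟨⟩
    exact ⟨rfl, rfl⟩
  obtain ⟨e1, e2⟩ := hinj _ _ hl.choose_spec.choose_spec.1
  rw [reduceCons, dif_pos hl, e2, e1]

theorem reduceCons_ghost_edge (h : H1) {i : Fin (s h).length} (j b : Fin (r h).length)
    (hi : (i : ℕ) = 0) (q : List (HGen H0 H1 s r)) :
    reduceCons K (HGen.ghost h i j) (HGen.edge h i b :: q) =
      (if j = b then wordVec K ((r h).get j) q else 0) -
        ∑ k : Fin (s h).length, if (k : ℕ) = 0 then 0 else
          wordVec K ((r h).get j) (HGen.ghost h k j :: HGen.edge h k b :: q) := by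
  have hl : ∃ b' q', HGen.edge h i b :: q = HGen.edge h i b' :: q' ∧ (i : ℕ) = 0 :=
    ⟨b, q, rfl, hi⟩
  have hinj : ∀ b' q', HGen.edge h i b :: q = HGen.edge h i b' :: q' → b' = b ∧ q' = q := by
    rintro _ _ ⟨⟩
    exact ⟨rfl, rfl⟩
  obtain ⟨e1, e2⟩ := hinj _ _ hl.choose_spec.choose_spec.1
  rw [reduceCons, dif_pos hl, e2, e1]

theorem reduceCons_edge {h : H1} {i : Fin (s h).length} {j : Fin (r h).length}
    {l : List (HGen H0 H1 s r)} (hf : ¬ ∃ a q, l = HGen.ghost h a j :: q ∧ (j : ℕ) = 0) :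
    reduceCons K (HGen.edge h i j) l = wordVec K ((s h).get i) (HGen.edge h i j :: l) := by
  rw [reduceCons, dif_neg hf]

theorem reduceCons_ghost {h : H1} {i : Fin (s h).length} {j : Fin (r h).length}
    {l : List (HGen H0 H1 s r)} (hf : ¬ ∃ b q, l = HGen.edge h i b :: q ∧ (i : ℕ) = 0) :
    reduceCons K (HGen.ghost h i j) l = wordVec K ((r h).get j) (HGen.ghost h i j :: l) := by
  rw [reduceCons, dif_neg hf]

theorem letterAct_vertex_wordVec {v : H0} {l : List (HGen H0 H1 s r)} (hl : NodFrom v l) :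
    letterAct K (HGen.vertex v) (wordVec K v l) = wordVec K v l :=
  letterAct_wordVec K hl rfl

theorem letterAct_vertex_reduceCons {g : HGen H0 H1 s r} {l : List (HGen H0 H1 s r)}
    (hl : NodFrom (letterRng g) l) :
    letterAct K (HGen.vertex (letterSrc g)) (reduceCons K g l) = reduceCons K g l := by
  cases g with
  | vertex v => exact letterAct_vertex_wordVec K hl
  | edge h i j =>
    by_cases hf : ∃ a q, l = HGen.ghost h a j :: q ∧ (j : ℕ) = 0
    · obtain ⟨a, q, rfl, hj⟩ := hf
      rw [reduceCons_edge_ghost K h i a hj, map_sub, map_sum]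
      congr 1
      · split_ifs with hia
        · subst hia
          exact letterAct_vertex_wordVec K hl.tail
        · exact map_zero _
      · refine Finset.sum_congr rfl fun k _ => ?_
        split_ifs with hk
        · exact map_zero _
        · exact letterAct_vertex_wordVec K (hl.edge_ghost i hk)
    · rw [reduceCons_edge K hf]
      exact letterAct_vertex_wordVec K (nodFrom_edge_cons hl hf)
  | ghost h i j =>
    by_cases hf : ∃ b q, l = HGen.edge h i b :: q ∧ (i : ℕ) = 0
    · obtain ⟨b, q, rfl, hi⟩ := hf
      rw [reduceCons_ghost_edge K h j b hi, map_sub, map_sum]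
      congr 1
      · split_ifs with hjb
        · subst hjb
          exact letterAct_vertex_wordVec K hl.tail
        · exact map_zero _
      · refine Finset.sum_congr rfl fun k _ => ?_
        split_ifs with hk
        · exact map_zero _
        · exact letterAct_vertex_wordVec K (hl.ghost_edge j hk)
    · rw [reduceCons_ghost K hf]
      exact letterAct_vertex_wordVec K (nodFrom_ghost_cons hl hf)

theorem letterAct_src_mul (g : HGen H0 H1 s r) :
    letterAct K (HGen.vertex (letterSrc g)) * letterAct K g = letterAct K g := by
  refine Finsupp.lhom_ext' fun w => LinearMap.ext_ring ?_
  obtain ⟨v, l⟩ := w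
  change letterAct K _ (letterAct K g (wordVec K v l)) = letterAct K g (wordVec K v l)
  by_cases hl : NodFrom v l
  · by_cases hv : letterRng g = v
    · subst hv
      rw [letterAct_wordVec K hl rfl, letterAct_vertex_reduceCons K hl]
    · rw [letterAct_of_ne K hv, map_zero]
  · rw [letterAct_of_not_nodFrom K hl, map_zero]

theorem letterAct_mul_rng (g : HGen H0 H1 s r) :
    letterAct K g * letterAct K (HGen.vertex (letterRng g)) = letterAct K g := by
  refine Finsupp.lhom_ext' fun w => LinearMap.ext_ring ?_
  obtain ⟨v, l⟩ := w
  change letterAct K g (letterAct K _ (wordVec K v l)) = letterAct K g (wordVec K v l)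
  by_cases hl : NodFrom v l
  · by_cases hv : letterRng g = v
    · subst hv
      rw [letterAct_vertex_wordVec K hl]
    · rw [letterAct_of_ne K hv, letterAct_of_ne K (g := HGen.vertex (letterRng g)) hv, map_zero]
  · rw [letterAct_of_not_nodFrom K hl, letterAct_of_not_nodFrom K hl, map_zero]

theorem letterAct_vertex_mul_vertex (u v : H0) :
    letterAct K (HGen.vertex u : HGen H0 H1 s r) * letterAct K (HGen.vertex v) =
      if u = v then letterAct K (HGen.vertex u) else 0 := by
  split_ifs with huv
  · subst huv
    exact letterAct_src_mul K (HGen.vertex u)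
  · refine Finsupp.lhom_ext' fun w => LinearMap.ext_ring ?_
    obtain ⟨v', l⟩ := w
    change letterAct K _ (letterAct K _ (wordVec K v' l)) = 0
    by_cases hl : NodFrom v' l
    · by_cases hv : v = v'
      · subst hv
        rw [letterAct_vertex_wordVec K hl]
        exact letterAct_of_ne K huv
      · rw [letterAct_of_ne K (g := HGen.vertex _) hv, map_zero]
    · rw [letterAct_of_not_nodFrom K hl, map_zero]

theorem sum_ite_val_eq_zero {M : Type} [AddCommGroup M] {n : ℕ} (hn : 0 < n) (d : M)
    (F : Fin n → M) :
    ∑ k : Fin n, (if (k : ℕ) = 0 then d - ∑ k' : Fin n, (if (k' : ℕ) = 0 then 0 else F k')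
      else F k) = d := by
  obtain ⟨m, rfl⟩ := Nat.exists_eq_succ_of_ne_zero hn.ne'
  simp [Fin.sum_univ_succ]

theorem sum_letterAct_edge_ghost {h : H1} (hr : r h ≠ []) (i a : Fin (s h).length)
    {l : List (HGen H0 H1 s r)}
    (hl : ∀ k, NodFrom ((r h).get k) (HGen.ghost h a k :: l)) :
    ∑ k, letterAct K (HGen.edge h i k) (wordVec K ((r h).get k) (HGen.ghost h a k :: l)) =
      if i = a then wordVec K ((s h).get i) l else 0 := by
  rw [← sum_ite_val_eq_zero (List.length_pos_iff.2 hr)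
    (if i = a then wordVec K ((s h).get i) l else 0)
    fun k => wordVec K ((s h).get i) (HGen.edge h i k :: HGen.ghost h a k :: l)]
  refine Finset.sum_congr rfl fun k _ => ?_
  rw [letterAct_wordVec K (hl k) rfl]
  by_cases hk : (k : ℕ) = 0
  · rw [if_pos hk, reduceCons_edge_ghost K h i a hk]
  · rw [if_neg hk, reduceCons_edge K (by rintro ⟨-, -, -, h0⟩; exact hk h0)]

theorem sum_letterAct_ghost_edge {h : H1} (hs : s h ≠ []) (j b : Fin (r h).length)
    {l : List (HGen H0 H1 s r)}
    (hl : ∀ k, NodFrom ((s h).get k) (HGen.edge h k b :: l)) :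
    ∑ k, letterAct K (HGen.ghost h k j) (wordVec K ((s h).get k) (HGen.edge h k b :: l)) =
      if j = b then wordVec K ((r h).get j) l else 0 := by
  rw [← sum_ite_val_eq_zero (List.length_pos_iff.2 hs)
    (if j = b then wordVec K ((r h).get j) l else 0)
    fun k => wordVec K ((r h).get j) (HGen.ghost h k j :: HGen.edge h k b :: l)]
  refine Finset.sum_congr rfl fun k _ => ?_
  rw [letterAct_wordVec K (hl k) rfl]
  by_cases hk : (k : ℕ) = 0
  · rw [if_pos hk, reduceCons_ghost_edge K h j b hk]
  · rw [if_neg hk, reduceCons_ghost K (by rintro ⟨-, -, -, h0⟩; exact hk h0)]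

theorem letterAct_edge_mul_ghost {h : H1} (hr : r h ≠ []) (i i' : Fin (s h).length) :
    ∑ k : Fin (r h).length,
        letterAct K (HGen.edge h i k : HGen H0 H1 s r) * letterAct K (HGen.ghost h i' k) =
      if i = i' then letterAct K (HGen.vertex ((s h).get i)) else 0 := by
  refine Finsupp.lhom_ext' fun w => LinearMap.ext_ring ?_
  obtain ⟨v, l⟩ := w
  suffices hsum : ∑ k, letterAct K (HGen.edge h i k)
      (letterAct K (HGen.ghost h i' k) (wordVec K v l)) =
        if i = i' then letterAct K (HGen.vertex ((s h).get i)) (wordVec K v l) else 0 by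
    split_ifs at hsum ⊢ <;> simpa [LinearMap.sum_apply] using hsum
  by_cases hl : NodFrom v l
  swap
  · simp [letterAct_of_not_nodFrom K hl]
  by_cases hv : (s h).get i' = v
  swap
  · have hz : (if i = i' then letterAct K (HGen.vertex ((s h).get i)) (wordVec K v l) else 0)
        = 0 := by
      split_ifs with hi
      · subst hi
        exact letterAct_of_ne K hv
      · rfl
    rw [hz]
    exact Finset.sum_eq_zero fun k _ => by
      rw [letterAct_of_ne K (g := HGen.ghost h i' k) hv, map_zero]
  subst hv
  have hrhs : (if i = i' then letterAct K (HGen.vertex ((s h).get i))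
      (wordVec K ((s h).get i') l) else 0) =
        if i = i' then wordVec K ((s h).get i) l else 0 := by
    split_ifs with hi
    · subst hi
      exact letterAct_vertex_wordVec K hl
    · rfl
  rw [hrhs]
  by_cases hf : ∃ b q, l = HGen.edge h i' b :: q ∧ (i' : ℕ) = 0
  · obtain ⟨m, q, rfl, hi'⟩ := hf
    have hact : ∀ k, letterAct K (HGen.edge h i k) (letterAct K (HGen.ghost h i' k)
        (wordVec K ((s h).get i') (HGen.edge h i' m :: q))) =
          (if k = m then wordVec K ((s h).get i) (HGen.edge h i m :: q) else 0) -
            ∑ n : Fin (s h).length, if (n : ℕ) = 0 then 0 else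
              letterAct K (HGen.edge h i k) (wordVec K ((r h).get k)
                (HGen.ghost h n k :: HGen.edge h n m :: q)) := by
      intro k
      rw [letterAct_wordVec K (g := HGen.ghost h i' k) hl rfl,
        reduceCons_ghost_edge K h k m hi', map_sub, map_sum]
      congr 1
      · split_ifs with hk
        · subst hk
          rw [letterAct_wordVec K (g := HGen.edge h i k) (v := (r h).get k) hl.tail rfl,
            reduceCons_edge K]
          rintro ⟨a, q', rfl, hk⟩
          exact (nodFrom_cons.1 hl).2.2.2 _ _ rfl ⟨rfl, hk, hk⟩
        · exact map_zero _
      · refine Finset.sum_congr rfl fun n _ => ?_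
        split_ifs
        · exact map_zero _
        · rfl
    simp_rw [hact]
    rw [Finset.sum_sub_distrib, Finset.sum_comm]
    have hinner : ∀ n : Fin (s h).length, (∑ k : Fin (r h).length, if (n : ℕ) = 0 then 0 else
        letterAct K (HGen.edge h i k) (wordVec K ((r h).get k)
          (HGen.ghost h n k :: HGen.edge h n m :: q))) =
        if i = n then (if (i : ℕ) = 0 then 0 else
          wordVec K ((s h).get i) (HGen.edge h i m :: q)) else 0 := by
      intro n
      by_cases hn : (n : ℕ) = 0
      · simp only [hn, if_true, Finset.sum_const_zero]
        split_ifs with h1 h2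
        · rfl
        · subst h1
          exact absurd hn h2
        · rfl
      · simp only [hn, if_false]
        rw [sum_letterAct_edge_ghost K hr i n fun k => hl.ghost_edge k hn]
        split_ifs with h1 h2
        · subst h1
          exact absurd h2 hn
        · subst h1
          rfl
        · rfl
    simp_rw [hinner]
    simp only [Finset.sum_ite_eq, Finset.sum_ite_eq', Finset.mem_univ, if_true]
    by_cases hi : i = i'
    · subst hi
      simp [hi']
    · have : (i : ℕ) ≠ 0 := fun h0 => hi (Fin.ext (h0.trans hi'.symm))
      simp [hi, this]
  · rw [← sum_letterAct_edge_ghost K hr i i' fun k => nodFrom_ghost_cons hl hf]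
    refine Finset.sum_congr rfl fun k _ => ?_
    rw [letterAct_wordVec K (g := HGen.ghost h i' k) hl rfl, reduceCons_ghost K hf]

theorem letterAct_ghost_mul_edge {h : H1} (hs : s h ≠ []) (j j' : Fin (r h).length) :
    ∑ k : Fin (s h).length,
        letterAct K (HGen.ghost h k j : HGen H0 H1 s r) * letterAct K (HGen.edge h k j') =
      if j = j' then letterAct K (HGen.vertex ((r h).get j)) else 0 := by
  refine Finsupp.lhom_ext' fun w => LinearMap.ext_ring ?_
  obtain ⟨v, l⟩ := w
  suffices hsum : ∑ k, letterAct K (HGen.ghost h k j)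
      (letterAct K (HGen.edge h k j') (wordVec K v l)) =
        if j = j' then letterAct K (HGen.vertex ((r h).get j)) (wordVec K v l) else 0 by
    split_ifs at hsum ⊢ <;> simpa [LinearMap.sum_apply] using hsum
  by_cases hl : NodFrom v l
  swap
  · simp [letterAct_of_not_nodFrom K hl]
  by_cases hv : (r h).get j' = v
  swap
  · have hz : (if j = j' then letterAct K (HGen.vertex ((r h).get j)) (wordVec K v l) else 0)
        = 0 := by
      split_ifs with hj
      · subst hj
        exact letterAct_of_ne K hv
      · rfl
    rw [hz]
    exact Finset.sum_eq_zero fun k _ => by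
      rw [letterAct_of_ne K (g := HGen.edge h k j') hv, map_zero]
  subst hv
  have hrhs : (if j = j' then letterAct K (HGen.vertex ((r h).get j))
      (wordVec K ((r h).get j') l) else 0) =
        if j = j' then wordVec K ((r h).get j) l else 0 := by
    split_ifs with hj
    · subst hj
      exact letterAct_vertex_wordVec K hl
    · rfl
  rw [hrhs]
  by_cases hf : ∃ a q, l = HGen.ghost h a j' :: q ∧ (j' : ℕ) = 0
  · obtain ⟨m, q, rfl, hj'⟩ := hf
    have hact : ∀ k, letterAct K (HGen.ghost h k j) (letterAct K (HGen.edge h k j')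
        (wordVec K ((r h).get j') (HGen.ghost h m j' :: q))) =
          (if k = m then wordVec K ((r h).get j) (HGen.ghost h m j :: q) else 0) -
            ∑ n : Fin (r h).length, if (n : ℕ) = 0 then 0 else
              letterAct K (HGen.ghost h k j) (wordVec K ((s h).get k)
                (HGen.edge h k n :: HGen.ghost h m n :: q)) := by
      intro k
      rw [letterAct_wordVec K (g := HGen.edge h k j') hl rfl,
        reduceCons_edge_ghost K h k m hj', map_sub, map_sum]
      congr 1
      · split_ifs with hk
        · subst hk
          rw [letterAct_wordVec K (g := HGen.ghost h k j) (v := (s h).get k) hl.tail rfl,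
            reduceCons_ghost K]
          rintro ⟨a, q', rfl, hk⟩
          exact (nodFrom_cons.1 hl).2.2.2 _ _ rfl ⟨rfl, hk, hk⟩
        · exact map_zero _
      · refine Finset.sum_congr rfl fun n _ => ?_
        split_ifs
        · exact map_zero _
        · rfl
    simp_rw [hact]
    rw [Finset.sum_sub_distrib, Finset.sum_comm]
    have hinner : ∀ n : Fin (r h).length, (∑ k : Fin (s h).length, if (n : ℕ) = 0 then 0 else
        letterAct K (HGen.ghost h k j) (wordVec K ((s h).get k)
          (HGen.edge h k n :: HGen.ghost h m n :: q))) =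
        if j = n then (if (j : ℕ) = 0 then 0 else
          wordVec K ((r h).get j) (HGen.ghost h m j :: q)) else 0 := by
      intro n
      by_cases hn : (n : ℕ) = 0
      · simp only [hn, if_true, Finset.sum_const_zero]
        split_ifs with h1 h2
        · rfl
        · subst h1
          exact absurd hn h2
        · rfl
      · simp only [hn, if_false]
        rw [sum_letterAct_ghost_edge K hs j n fun k => hl.edge_ghost k hn]
        split_ifs with h1 h2
        · subst h1
          exact absurd h2 hn
        · subst h1
          rfl
        · rfl
    simp_rw [hinner]
    simp only [Finset.sum_ite_eq, Finset.sum_ite_eq', Finset.mem_univ, if_true]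
    by_cases hj : j = j'
    · subst hj
      simp [hj']
    · have : (j : ℕ) ≠ 0 := fun h0 => hj (Fin.ext (h0.trans hj'.symm))
      simp [hj, this]
  · rw [← sum_letterAct_ghost_edge K hs j j' fun k => nodFrom_edge_cons hl hf]
    refine Finset.sum_congr rfl fun k _ => ?_
    rw [letterAct_wordVec K (g := HGen.edge h k j') hl rfl, reduceCons_edge K hf]

/-- The representation of the ambient algebra on `WordSpace` given by `letterAct`. -/
noncomputable def rep (hs : ∀ h, s h ≠ []) (hr : ∀ h, r h ≠ []) :
    Ambient K H0 H1 s r →ₐ[K] Module.End K (WordSpace K H0 H1 s r) :=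
  RingQuot.liftAlgHom K ⟨FreeAlgebra.lift K (letterAct K), by
    intro x y hxy
    cases hxy with
    | vtx u v =>
      simpa [apply_ite (FreeAlgebra.lift K (letterAct K))] using
        letterAct_vertex_mul_vertex K u v
    | src_edge h i j => simpa [letterSrc, letterRng] using letterAct_src_mul K (HGen.edge h i j)
    | edge_rng h i j => simpa [letterSrc, letterRng] using letterAct_mul_rng K (HGen.edge h i j)
    | rng_ghost h i j => simpa [letterSrc, letterRng] using letterAct_src_mul K (HGen.ghost h i j)
    | ghost_src h i j => simpa [letterSrc, letterRng] using letterAct_mul_rng K (HGen.ghost h i j)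
    | cuntz1 h i i' =>
      simpa [apply_ite (FreeAlgebra.lift K (letterAct K))] using
        letterAct_edge_mul_ghost K (hr h) i i'
    | cuntz2 h j j' =>
      simpa [apply_ite (FreeAlgebra.lift K (letterAct K))] using
        letterAct_ghost_mul_edge K (hs h) j j'⟩

theorem rep_amb (hs : ∀ h, s h ≠ []) (hr : ∀ h, r h ≠ []) (g : HGen H0 H1 s r) :
    rep K hs hr (amb K H0 H1 s r g) = letterAct K g := by
  simp [rep, amb]

theorem amb_vertex_mul_vertex (u v : H0) :
    amb K H0 H1 s r (HGen.vertex u) * amb K H0 H1 s r (HGen.vertex v) =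
      if u = v then amb K H0 H1 s r (HGen.vertex u) else 0 := by
  have e := RingQuot.mkAlgHom_rel K (Rel.vtx (K := K) (s := s) (r := r) u v)
  rw [map_mul] at e
  refine e.trans ?_
  split_ifs
  · rfl
  · exact map_zero _

theorem amb_src_mul (g : HGen H0 H1 s r) :
    amb K H0 H1 s r (HGen.vertex (letterSrc g)) * amb K H0 H1 s r g = amb K H0 H1 s r g := by
  cases g with
  | vertex v => exact (amb_vertex_mul_vertex K v v).trans (if_pos rfl)
  | edge h i j =>
    exact (map_mul _ _ _).symm.trans (RingQuot.mkAlgHom_rel K (Rel.src_edge h i j))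
  | ghost h i j =>
    exact (map_mul _ _ _).symm.trans (RingQuot.mkAlgHom_rel K (Rel.rng_ghost h i j))

theorem amb_mul_rng (g : HGen H0 H1 s r) :
    amb K H0 H1 s r g * amb K H0 H1 s r (HGen.vertex (letterRng g)) = amb K H0 H1 s r g := by
  cases g with
  | vertex v => exact (amb_vertex_mul_vertex K v v).trans (if_pos rfl)
  | edge h i j =>
    exact (map_mul _ _ _).symm.trans (RingQuot.mkAlgHom_rel K (Rel.edge_rng h i j))
  | ghost h i j =>
    exact (map_mul _ _ _).symm.trans (RingQuot.mkAlgHom_rel K (Rel.ghost_src h i j))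

theorem sum_amb_edge_mul_ghost (h : H1) (i i' : Fin (s h).length) :
    ∑ k, amb K H0 H1 s r (HGen.edge h i k) * amb K H0 H1 s r (HGen.ghost h i' k) =
      if i = i' then amb K H0 H1 s r (HGen.vertex ((s h).get i)) else 0 := by
  have e := RingQuot.mkAlgHom_rel K (Rel.cuntz1 (K := K) (s := s) (r := r) h i i')
  simp only [map_sum, map_mul] at e
  refine e.trans ?_
  split_ifs
  · rfl
  · exact map_zero _

theorem sum_amb_ghost_mul_edge (h : H1) (j j' : Fin (r h).length) :
    ∑ k, amb K H0 H1 s r (HGen.ghost h k j) * amb K H0 H1 s r (HGen.edge h k j') =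
      if j = j' then amb K H0 H1 s r (HGen.vertex ((r h).get j)) else 0 := by
  have e := RingQuot.mkAlgHom_rel K (Rel.cuntz2 (K := K) (s := s) (r := r) h j j')
  simp only [map_sum, map_mul] at e
  refine e.trans ?_
  split_ifs
  · rfl
  · exact map_zero _

/-- The element of the ambient algebra represented by the word `l` starting at `v`. -/
noncomputable def ambWord (v : H0) (l : List (HGen H0 H1 s r)) : Ambient K H0 H1 s r :=
  amb K H0 H1 s r (HGen.vertex v) * (l.map (amb K H0 H1 s r)).prod

theorem ambWord_cons (x : HGen H0 H1 s r) (l : List (HGen H0 H1 s r)) :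
    ambWord K (letterSrc x) (x :: l) =
      amb K H0 H1 s r x * (l.map (amb K H0 H1 s r)).prod := by
  rw [ambWord, List.map_cons, List.prod_cons, ← mul_assoc, amb_src_mul]

theorem amb_mul_ambWord (x : HGen H0 H1 s r) (l : List (HGen H0 H1 s r)) :
    amb K H0 H1 s r x * ambWord K (letterRng x) l = ambWord K (letterSrc x) (x :: l) := by
  rw [ambWord_cons, ambWord, ← mul_assoc, amb_mul_rng]

theorem amb_mul_ambWord_of_ne {x : HGen H0 H1 s r} {v : H0} (hv : letterRng x ≠ v)
    (l : List (HGen H0 H1 s r)) : amb K H0 H1 s r x * ambWord K v l = 0 := by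
  rw [← amb_mul_rng, ambWord, mul_assoc, ← mul_assoc (amb K H0 H1 s r (HGen.vertex _)),
    amb_vertex_mul_vertex, if_neg hv, zero_mul, mul_zero]

/-- The subspace of the ambient algebra spanned by the nod-paths. -/
noncomputable def nodSpan (H0 H1 : Type) (s r : H1 → List H0) :
    Submodule K (Ambient K H0 H1 s r) :=
  Submodule.span K (Set.range fun w : {w : H0 × List (HGen H0 H1 s r) // NodFrom w.1 w.2} =>
    ambWord K w.1.1 w.1.2)

theorem ambWord_mem_nodSpan {v : H0} {l : List (HGen H0 H1 s r)} (hl : NodFrom v l) :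
    ambWord K v l ∈ nodSpan K H0 H1 s r :=
  Submodule.subset_span ⟨⟨(v, l), hl⟩, rfl⟩

theorem eq_sub_sum_of_val_eq_zero {M : Type} [AddCommGroup M] {n : ℕ} {j : Fin n}
    (hj : (j : ℕ) = 0) {d : M} {F : Fin n → M} (hd : ∑ k, F k = d) :
    F j = d - ∑ k : Fin n, if (k : ℕ) = 0 then 0 else F k := by
  obtain ⟨m, rfl⟩ := Nat.exists_eq_succ_of_ne_zero (Fin.pos j).ne'
  obtain rfl : j = 0 := Fin.ext hj
  simp [← hd, Fin.sum_univ_succ]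

theorem amb_mul_ambWord_mem_nodSpan (x : HGen H0 H1 s r) {v : H0}
    {l : List (HGen H0 H1 s r)} (hl : NodFrom v l) :
    amb K H0 H1 s r x * ambWord K v l ∈ nodSpan K H0 H1 s r := by
  by_cases hv : letterRng x = v
  swap
  · rw [amb_mul_ambWord_of_ne K hv]
    exact Submodule.zero_mem _
  subst hv
  cases x with
  | vertex v =>
    rw [ambWord, ← mul_assoc, amb_mul_rng]
    exact ambWord_mem_nodSpan K hl
  | edge h i j =>
    by_cases hf : ∃ a q, l = HGen.ghost h a j :: q ∧ (j : ℕ) = 0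
    · obtain ⟨a, q, rfl, hj⟩ := hf
      rw [amb_mul_ambWord, ambWord_cons, List.map_cons, List.prod_cons, ← mul_assoc,
        eq_sub_sum_of_val_eq_zero hj (sum_amb_edge_mul_ghost K h i a), sub_mul, Finset.sum_mul]
      refine Submodule.sub_mem _ ?_ (Submodule.sum_mem _ fun k _ => ?_)
      · split_ifs with hia
        · subst hia
          exact ambWord_mem_nodSpan K hl.tail
        · rw [zero_mul]
          exact Submodule.zero_mem _
      · split_ifs with hk
        · rw [zero_mul]
          exact Submodule.zero_mem _
        · have hw := ambWord_mem_nodSpan K (hl.edge_ghost i hk)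
          rw [mul_assoc]
          exact (ambWord_cons K (HGen.edge h i k) (HGen.ghost h a k :: q)) ▸ hw
    · rw [amb_mul_ambWord]
      exact ambWord_mem_nodSpan K (nodFrom_edge_cons hl hf)
  | ghost h i j =>
    by_cases hf : ∃ b q, l = HGen.edge h i b :: q ∧ (i : ℕ) = 0
    · obtain ⟨b, q, rfl, hi⟩ := hf
      rw [amb_mul_ambWord, ambWord_cons, List.map_cons, List.prod_cons, ← mul_assoc,
        eq_sub_sum_of_val_eq_zero (F := fun k => amb K H0 H1 s r (HGen.ghost h k j) *
          amb K H0 H1 s r (HGen.edge h k b)) hi (sum_amb_ghost_mul_edge K h j b),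
        sub_mul, Finset.sum_mul]
      refine Submodule.sub_mem _ ?_ (Submodule.sum_mem _ fun k _ => ?_)
      · split_ifs with hjb
        · subst hjb
          exact ambWord_mem_nodSpan K hl.tail
        · rw [zero_mul]
          exact Submodule.zero_mem _
      · split_ifs with hk
        · rw [zero_mul]
          exact Submodule.zero_mem _
        · have hw := ambWord_mem_nodSpan K (hl.ghost_edge j hk)
          rw [mul_assoc]
          exact (ambWord_cons K (HGen.ghost h k j) (HGen.edge h k b :: q)) ▸ hw
    · rw [amb_mul_ambWord]
      exact ambWord_mem_nodSpan K (nodFrom_ghost_cons hl hf)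

theorem amb_mul_mem_nodSpan (x : HGen H0 H1 s r) {y : Ambient K H0 H1 s r}
    (hy : y ∈ nodSpan K H0 H1 s r) : amb K H0 H1 s r x * y ∈ nodSpan K H0 H1 s r := by
  have hle : nodSpan K H0 H1 s r ≤
      (nodSpan K H0 H1 s r).comap (LinearMap.mulLeft K (amb K H0 H1 s r x)) := by
    refine Submodule.span_le.2 ?_
    rintro _ ⟨⟨w, hw⟩, rfl⟩
    exact amb_mul_ambWord_mem_nodSpan K x hw
  exact hle hy

theorem mem_nodSpan_of_mem_LPAsub {x : Ambient K H0 H1 s r} (hx : x ∈ LPAsub K H0 H1 s r) :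
    x ∈ nodSpan K H0 H1 s r := by
  suffices hS : x ∈ nodSpan K H0 H1 s r ∧
      ∀ y ∈ nodSpan K H0 H1 s r, x * y ∈ nodSpan K H0 H1 s r from hS.1
  refine NonUnitalAlgebra.adjoin_induction
    (p := fun x _ => x ∈ nodSpan K H0 H1 s r ∧
      ∀ y ∈ nodSpan K H0 H1 s r, x * y ∈ nodSpan K H0 H1 s r) ?_ ?_ ?_ ?_ ?_ hx
  · rintro _ ⟨g, rfl⟩
    refine ⟨?_, fun y hy => amb_mul_mem_nodSpan K g hy⟩
    have hg := amb_mul_ambWord_mem_nodSpan K g (nodFrom_nil (letterRng g))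
    simpa [ambWord, amb_mul_rng] using hg
  · rintro x y - - ⟨hx, hx'⟩ ⟨hy, hy'⟩
    refine ⟨Submodule.add_mem _ hx hy, fun z hz => ?_⟩
    rw [add_mul]
    exact Submodule.add_mem _ (hx' z hz) (hy' z hz)
  · exact ⟨Submodule.zero_mem _, fun z _ => by simp⟩
  · rintro x y - - ⟨hx, hx'⟩ ⟨hy, hy'⟩
    refine ⟨hx' y hy, fun z hz => ?_⟩
    rw [mul_assoc]
    exact hx' _ (hy' z hz)
  · rintro c x - ⟨hx, hx'⟩
    refine ⟨Submodule.smul_mem _ c hx, fun z hz => ?_⟩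
    rw [smul_mul_assoc]
    exact Submodule.smul_mem _ c (hx' z hz)

/-- The end vertex of the word `l` starting at `v`. -/
def endVertex (v : H0) (l : List (HGen H0 H1 s r)) : H0 :=
  l.foldl (fun _ x => letterRng x) v

theorem rep_ambWord (hs : ∀ h, s h ≠ []) (hr : ∀ h, r h ≠ []) (e : H0)
    {l : List (HGen H0 H1 s r)} : ∀ {v : H0}, NodFrom v l →
    rep K hs hr (ambWord K v l) (wordVec K e []) =
      if endVertex v l = e then wordVec K v l else 0 := by
  induction l with
  | nil =>
    intro v hl
    rw [ambWord, List.map_nil, List.prod_nil, mul_one, rep_amb]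
    change _ = if v = e then _ else 0
    split_ifs with hv
    · rw [← hv]
      exact letterAct_vertex_wordVec K hl
    · exact letterAct_of_ne K (g := HGen.vertex v) hv
  | cons x l ih =>
    intro v hl
    obtain ⟨rfl, hx, hl', hf⟩ := nodFrom_cons.1 hl
    rw [← amb_mul_ambWord, map_mul, Module.End.mul_apply, ih hl', rep_amb]
    change letterAct K x (if endVertex (letterRng x) l = e then _ else 0) =
      if endVertex (letterRng x) l = e then _ else 0
    split_ifs
    · rw [letterAct_wordVec K hl' rfl]
      cases x with
      | vertex v => exact absurd trivial hx
      | edge h i j =>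
        refine reduceCons_edge K ?_
        rintro ⟨a, q, rfl, hj⟩
        exact hf _ _ rfl ⟨rfl, hj, hj⟩
      | ghost h i j =>
        refine reduceCons_ghost K ?_
        rintro ⟨b, q, rfl, hi⟩
        exact hf _ _ rfl ⟨rfl, hi, hi⟩
    · exact map_zero _

theorem linearIndependent_ambWord (hs : ∀ h, s h ≠ []) (hr : ∀ h, r h ≠ []) :
    LinearIndependent K (fun w : {w : H0 × List (HGen H0 H1 s r) // NodFrom w.1 w.2} =>
      ambWord K w.1.1 w.1.2) := by
  refine linearIndependent_iff'.2 fun t c hc w₀ hw₀ => ?_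
  have e := congrArg (fun a => rep K hs hr a
    (wordVec K (endVertex w₀.1.1 w₀.1.2) []) w₀.1) hc
  simp only [map_sum, map_smul, LinearMap.sum_apply, LinearMap.smul_apply, map_zero,
    LinearMap.zero_apply, Finsupp.coe_zero, Pi.zero_apply, Finsupp.finsetSum_apply,
    Finsupp.smul_apply] at e
  rw [Finset.sum_eq_single w₀, rep_ambWord K hs hr _ w₀.2, if_pos rfl] at e
  · simpa using e
  · intro w _ hw
    rw [rep_ambWord K hs hr _ w.2]
    split_ifs
    · rw [Finsupp.single_eq_of_ne (fun h => hw (Subtype.ext h.symm)), smul_zero]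
    · simp
  · exact fun h => absurd hw₀ h

/-- The list of letters of the path given by the word `l` starting at `v`. -/
def toPath (v : H0) : List (HGen H0 H1 s r) → List (HGen H0 H1 s r)
  | [] => [HGen.vertex v]
  | x :: l => x :: l

theorem isNodPath_toPath {v : H0} {l : List (HGen H0 H1 s r)} (hl : NodFrom v l) :
    IsNodPath (toPath v l) := by
  cases l with
  | nil => exact ⟨Or.inl ⟨v, rfl⟩, List.isChain_singleton _⟩
  | cons x l =>
    have hc : List.IsChain Follows (x :: l) := (List.isChain_cons_cons.1 hl).2
    refine ⟨Or.inr ⟨List.cons_ne_nil _ _, ?_, hc.imp fun _ _ h => h.1⟩,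
      hc.imp fun _ _ h => h.2.2⟩
    clear hc
    change ∀ y ∈ x :: l, ¬ IsVertexLetter y
    induction l generalizing v x with
    | nil => simpa using (nodFrom_cons.1 hl).2.1
    | cons y l ih =>
      intro z hz
      rcases List.mem_cons.1 hz with rfl | hz
      · exact (nodFrom_cons.1 hl).2.1
      · exact ih y hl.tail z hz

theorem exists_toPath_eq {p : List (HGen H0 H1 s r)} (hp : IsNodPath p) :
    ∃ w : {w : H0 × List (HGen H0 H1 s r) // NodFrom w.1 w.2}, toPath w.1.1 w.1.2 = p := by
  obtain ⟨⟨v, rfl⟩ | ⟨hne, hv, hc⟩, hf⟩ := hp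
  · exact ⟨⟨(v, []), nodFrom_nil v⟩, rfl⟩
  · cases p with
    | nil => exact absurd rfl hne
    | cons x l =>
      refine ⟨⟨(letterSrc x, x :: l), ?_⟩, rfl⟩
      clear hne
      change NodFrom (letterSrc x) (x :: l)
      induction l generalizing x with
      | nil =>
        exact nodFrom_cons.2 ⟨rfl, hv x (by simp), nodFrom_nil _, by simp⟩
      | cons y l ih =>
        obtain ⟨hc1, hc2⟩ := List.isChain_cons_cons.1 hc
        obtain ⟨hf1, hf2⟩ := List.isChain_cons_cons.1 hf
        refine nodFrom_cons.2 ⟨rfl, hv x (by simp), ?_, ?_⟩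
        · rw [hc1]
          exact ih y hf2 (fun z hz => hv z (List.mem_cons_of_mem _ hz)) hc2
        · rintro _ _ ⟨⟩
          exact hf1

theorem coe_wordProd_cons (x : HGen H0 H1 s r) (l : List (HGen H0 H1 s r)) :
    (wordProd K (x :: l) : Ambient K H0 H1 s r) = ((x :: l).map (amb K H0 H1 s r)).prod := by
  induction l generalizing x with
  | nil => simp [wordProd, genL]
  | cons y l ih =>
    rw [List.map_cons, List.prod_cons, ← ih y]
    rfl

theorem coe_wordProd_toPath {v : H0} {l : List (HGen H0 H1 s r)} (hl : NodFrom v l) :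
    (wordProd K (toPath v l) : Ambient K H0 H1 s r) = ambWord K v l := by
  cases l with
  | nil => simp [toPath, wordProd, genL, ambWord]
  | cons x l =>
    obtain ⟨rfl, -⟩ := nodFrom_cons.1 hl
    rw [toPath, coe_wordProd_cons, ambWord_cons, List.map_cons, List.prod_cons]

end HLPA

open HLPA in
/-- **Corollary 5.5 (Corollary \ref{corbasis}).** The images of the nod-paths in
`L_K(H)` form a basis of the `K`-vector space `L_K(H)`. -/
theorem stmt_11 (K : Type) [Field K] (H0 H1 : Type) [Nonempty H0]
    (s r : H1 → List H0) (hs : ∀ h, s h ≠ []) (hr : ∀ h, r h ≠ []) :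
    LinearIndependent K
      (fun p : {l : List (HGen H0 H1 s r) // IsNodPath l} => wordProd K p.val) ∧
    Submodule.span K
      (Set.range fun p : {l : List (HGen H0 H1 s r) // IsNodPath l} => wordProd K p.val)
      = ⊤ := by
  let φ : LPA K H0 H1 s r →ₗ[K] Ambient K H0 H1 s r :=
    { toFun := Subtype.val, map_add' := fun _ _ => rfl, map_smul' := fun _ _ => rfl }
  have hφ : Function.Injective φ := Subtype.val_injective
  choose f hf using fun p : {l : List (HGen H0 H1 s r) // IsNodPath l} => exists_toPath_eq p.2
  have hval : ∀ p, φ (wordProd K p.1) = ambWord K (f p).1.1 (f p).1.2 := fun p => by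
    rw [← coe_wordProd_toPath K (f p).2, hf p]
    rfl
  constructor
  · refine LinearIndependent.of_comp φ ?_
    have hinj : Function.Injective f := fun p q hpq =>
      Subtype.ext (by rw [← hf p, ← hf q, hpq])
    convert (linearIndependent_ambWord K hs hr).comp f hinj using 1
    exact funext hval
  · refine eq_top_iff.2 fun x _ => ?_
    have hle : nodSpan K H0 H1 s r ≤ (Submodule.span K (Set.range fun p :
        {l : List (HGen H0 H1 s r) // IsNodPath l} => wordProd K p.val)).map φ := by
      refine Submodule.span_le.2 ?_
      rintro _ ⟨⟨w, hw⟩, rfl⟩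
      exact ⟨wordProd K (toPath w.1 w.2),
        Submodule.subset_span ⟨⟨_, isNodPath_toPath hw⟩, rfl⟩, coe_wordProd_toPath K hw⟩
    obtain ⟨y, hy, hyx⟩ := hle (mem_nodSpan_of_mem_LPAsub K x.2)
    exact hφ hyx ▸ hy
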